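/- Let K be a field and let S_1, S_2 be K-subalgebras of the polynomial ring K[x_1,...,x_n] each generated as a K-algebra by a finite set of monomials (i.e., elements of the form x_1^{a_1}···x_n^{a_n}). Then S_1 ∩ S_2 is a finitely generated K-algebra. -/

import Mathlib

theorem aux_fg_inf {N : Type*} [AddCommMonoid N] [IsCancelAdd N] {P Q : AddSubmonoid N}
    (hP : P.FG) (hQ : Q.FG) : (P ⊓ Q).FG := by
  obtain ⟨m, f, rfl⟩ := AddSubmonoid.fg_iff_exists_fin_addMonoidHom.1 hP
  obtain ⟨k, g, rfl⟩ := AddSubmonoid.fg_iff_exists_fin_addMonoidHom.1 hQ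
  have h := (AddSubmonoid.fg_eqLocusM (f.comp (AddMonoidHom.fst (Fin m → ℕ) (Fin k → ℕ)))
    (g.comp (AddMonoidHom.snd (Fin m → ℕ) (Fin k → ℕ)))).map
    (f.comp (AddMonoidHom.fst (Fin m → ℕ) (Fin k → ℕ)))
  convert h using 1
  ext x
  simp only [AddSubmonoid.mem_inf, AddMonoidHom.mem_mrange, AddSubmonoid.mem_map]
  constructor
  · rintro ⟨⟨a, rfl⟩, ⟨b, hb⟩⟩
    exact ⟨(a, b), hb.symm, rfl⟩
  · rintro ⟨⟨a, b⟩, hab, rfl⟩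
    exact ⟨⟨a, rfl⟩, ⟨b, Eq.symm hab⟩⟩

theorem aux_mem_adjoin {K σ : Type*} [Field K] (G : Set (σ →₀ ℕ)) (p : MvPolynomial σ K) :
    p ∈ Algebra.adjoin K ((fun a => MvPolynomial.monomial a (1 : K)) '' G) ↔
      ∀ a ∈ p.support, a ∈ AddSubmonoid.closure G := by
  classical
  constructor
  · intro hp
    induction hp using Algebra.adjoin_induction with
    | mem x hx =>
      obtain ⟨a, ha, rfl⟩ := hx
      intro b hb
      have := MvPolynomial.support_monomial_subset hb
      rw [Finset.mem_singleton] at this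
      exact this ▸ AddSubmonoid.subset_closure ha
    | algebraMap r =>
      intro b hb
      have := MvPolynomial.support_monomial_subset (s := 0) (a := r) hb
      rw [Finset.mem_singleton] at this
      exact this ▸ zero_mem _
    | add x y _ _ hx hy =>
      intro b hb
      rcases Finset.mem_union.1 (MvPolynomial.support_add hb) with h | h
      · exact hx b h
      · exact hy b h
    | mul x y _ _ hx hy =>
      intro b hb
      obtain ⟨c, hc, d, hd, rfl⟩ := Finset.mem_add.1 (MvPolynomial.support_mul x y hb)
      exact add_mem (hx c hc) (hy d hd)
  · intro h
    have key : ∀ a ∈ AddSubmonoid.closure G, MvPolynomial.monomial a (1 : K) ∈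
        Algebra.adjoin K ((fun a => MvPolynomial.monomial a (1 : K)) '' G) := by
      intro a ha
      induction ha using AddSubmonoid.closure_induction with
      | mem x hx => exact Algebra.subset_adjoin ⟨x, hx, rfl⟩
      | zero => exact one_mem _
      | add x y _ _ hx hy =>
        have := mul_mem hx hy
        rwa [MvPolynomial.monomial_mul, one_mul] at this
    rw [p.as_sum]
    refine sum_mem fun a ha => ?_
    have := Subalgebra.smul_mem _ (key a (h a ha)) (p.coeff a)
    rwa [MvPolynomial.smul_monomial, smul_eq_mul, mul_one] at this

/-- If `S₁, S₂` are `K`-subalgebras of `K[x_1,…,x_n]`, each generated as a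
`K`-algebra by a finite set of monomials, then `S₁ ∩ S₂` is a finitely generated
`K`-algebra. -/
theorem pushouts_stmt15 (K : Type*) [Field K] (n : ℕ)
    (S₁ S₂ : Subalgebra K (MvPolynomial (Fin n) K))
    (h₁ : ∃ G : Finset (Fin n →₀ ℕ),
      S₁ = Algebra.adjoin K
        ((fun a => MvPolynomial.monomial a (1 : K)) '' (G : Set (Fin n →₀ ℕ))))
    (h₂ : ∃ H : Finset (Fin n →₀ ℕ),
      S₂ = Algebra.adjoin K
        ((fun a => MvPolynomial.monomial a (1 : K)) '' (H : Set (Fin n →₀ ℕ)))) :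
    (S₁ ⊓ S₂).FG := by
  obtain ⟨G, rfl⟩ := h₁
  obtain ⟨H, rfl⟩ := h₂
  classical
  obtain ⟨T, hT⟩ := aux_fg_inf (P := AddSubmonoid.closure (G : Set (Fin n →₀ ℕ)))
    (Q := AddSubmonoid.closure (H : Set (Fin n →₀ ℕ))) ⟨G, rfl⟩ ⟨H, rfl⟩
  refine ⟨T.image (fun a => MvPolynomial.monomial a (1 : K)), ?_⟩
  ext p
  rw [Finset.coe_image, Algebra.mem_inf, aux_mem_adjoin, aux_mem_adjoin, aux_mem_adjoin, hT]
  simp only [AddSubmonoid.mem_inf]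
  exact ⟨fun h => ⟨fun a ha => (h a ha).1, fun a ha => (h a ha).2⟩,
    fun h a ha => ⟨h.1 a ha, h.2 a ha⟩⟩
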